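/- Let Pu = t·∂_t²u − 2·∂_x∂_t u + ∂_t u + a·∂_x u + b·∂_t u + c·u with a, b, c smooth on [0,∞)×ℝ and 2π-periodic in x, and assume b(0,x) ≥ 0 for all x ∈ ℝ. Then for every smooth 2π-periodic function u₀ : ℝ → ℝ and every f smooth on [0,∞)×ℝ and 2π-periodic in x, there exists a unique function u, smooth on [0,∞)×ℝ and 2π-periodic in x, such that Pu = f on [0,∞)×ℝ and u(0,x) = u₀(x) for all x ∈ ℝ. -/

import Mathlib

/-- Partial derivative in the first (time) variable. -/
noncomputable def pt (u : ℝ → ℝ → ℝ) : ℝ → ℝ → ℝ := fun t x => deriv (fun s => u s x) t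

/-- Partial derivative in the second (space) variable. -/
noncomputable def px (u : ℝ → ℝ → ℝ) : ℝ → ℝ → ℝ := fun t x => deriv (fun y => u t y) x

/-- Smooth up to the boundary `t = 0`, modelled as the restriction of a smooth
function on `ℝ²`. -/
def Smooth2 (u : ℝ → ℝ → ℝ) : Prop := ContDiff ℝ (⊤ : ℕ∞) (fun p : ℝ × ℝ => u p.1 p.2)

/-- `2π`-periodicity in the second variable. -/
def Periodic2 (u : ℝ → ℝ → ℝ) : Prop := ∀ t x : ℝ, u t (x + 2 * Real.pi) = u t x

/-- A general scalar wave operator on the Misner spacetime: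
`Pu = t·∂ₜ²u − 2·∂ₓ∂ₜu + ∂ₜu + a·∂ₓu + b·∂ₜu + c·u`. -/
noncomputable def MisnerP (a b c u : ℝ → ℝ → ℝ) : ℝ → ℝ → ℝ := fun t x =>
  t * pt (pt u) t x - 2 * px (pt u) t x + pt u t x
    + a t x * px u t x + b t x * pt u t x + c t x * u t x

namespace Misner

open Set Filter Topology MeasureTheory

noncomputable section

/-- Smooth functions on the plane that are `2π`-periodic in the second variable. -/
structure SmoothPer (u : ℝ → ℝ → ℝ) : Prop where
  smooth : Smooth2 u
  periodic : Periodic2 u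

section Calculus

variable {u v : ℝ → ℝ → ℝ}

theorem _root_.Smooth2.hasFDerivAt (hu : Smooth2 u) (p : ℝ × ℝ) :
    HasFDerivAt (fun p : ℝ × ℝ => u p.1 p.2)
      (fderiv ℝ (fun p : ℝ × ℝ => u p.1 p.2) p) p :=
  (hu.differentiable (by simp) p).hasFDerivAt

/-- Chain rule along a differentiable curve, before identifying the partial derivatives. -/
theorem _root_.Smooth2.hasDerivAt_curve_fderiv (hu : Smooth2 u) {g k : ℝ → ℝ} {dg dk s : ℝ}
    (hg : HasDerivAt g dg s) (hk : HasDerivAt k dk s) :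
    HasDerivAt (fun s => u (g s) (k s))
      (fderiv ℝ (fun p : ℝ × ℝ => u p.1 p.2) (g s, k s) (dg, dk)) s := by
  have h := (hu.hasFDerivAt (g s, k s)).comp_hasDerivAt s (hg.prodMk hk)
  exact h

theorem _root_.Smooth2.pt_eq (hu : Smooth2 u) (t x : ℝ) :
    pt u t x = fderiv ℝ (fun p : ℝ × ℝ => u p.1 p.2) (t, x) (1, 0) :=
  (hu.hasDerivAt_curve_fderiv (hasDerivAt_id t) (hasDerivAt_const t x)).deriv

theorem _root_.Smooth2.px_eq (hu : Smooth2 u) (t x : ℝ) :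
    px u t x = fderiv ℝ (fun p : ℝ × ℝ => u p.1 p.2) (t, x) (0, 1) :=
  (hu.hasDerivAt_curve_fderiv (hasDerivAt_const x t) (hasDerivAt_id x)).deriv

theorem _root_.Smooth2.fderiv_apply (hu : Smooth2 u) (t x a b : ℝ) :
    fderiv ℝ (fun p : ℝ × ℝ => u p.1 p.2) (t, x) (a, b) = a * pt u t x + b * px u t x := by
  have h : ((a, b) : ℝ × ℝ) = a • (1, 0) + b • (0, 1) := by simp
  rw [h, map_add, map_smul, map_smul, ← hu.pt_eq, ← hu.px_eq, smul_eq_mul, smul_eq_mul]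

theorem _root_.Smooth2.hasDerivAt_curve (hu : Smooth2 u) {g k : ℝ → ℝ} {dg dk s : ℝ}
    (hg : HasDerivAt g dg s) (hk : HasDerivAt k dk s) :
    HasDerivAt (fun s => u (g s) (k s)) (dg * pt u (g s) (k s) + dk * px u (g s) (k s)) s := by
  rw [← hu.fderiv_apply]
  exact hu.hasDerivAt_curve_fderiv hg hk

theorem _root_.Smooth2.hasDerivAt_fst (hu : Smooth2 u) (t x : ℝ) :
    HasDerivAt (fun s => u s x) (pt u t x) t := by
  simpa using hu.hasDerivAt_curve (hasDerivAt_id t) (hasDerivAt_const t x)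

theorem _root_.Smooth2.hasDerivAt_snd (hu : Smooth2 u) (t x : ℝ) :
    HasDerivAt (fun y => u t y) (px u t x) x := by
  simpa using hu.hasDerivAt_curve (hasDerivAt_const x t) (hasDerivAt_id x)

theorem _root_.Smooth2.pt (hu : Smooth2 u) : Smooth2 (pt u) := by
  have h : (fun p : ℝ × ℝ => _root_.pt u p.1 p.2) =
      fun p => fderiv ℝ (fun p : ℝ × ℝ => u p.1 p.2) p (1, 0) := by
    ext p; exact hu.pt_eq p.1 p.2
  unfold Smooth2
  rw [h]
  exact (hu.fderiv_right (m := (⊤ : ℕ∞)) (by simp)).clm_apply contDiff_const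

theorem _root_.Smooth2.px (hu : Smooth2 u) : Smooth2 (px u) := by
  have h : (fun p : ℝ × ℝ => _root_.px u p.1 p.2) =
      fun p => fderiv ℝ (fun p : ℝ × ℝ => u p.1 p.2) p (0, 1) := by
    ext p; exact hu.px_eq p.1 p.2
  unfold Smooth2
  rw [h]
  exact (hu.fderiv_right (m := (⊤ : ℕ∞)) (by simp)).clm_apply contDiff_const

theorem SmoothPer.pt (hu : SmoothPer u) : SmoothPer (pt u) where
  smooth := hu.smooth.pt
  periodic t x := by
    have h : (fun s => u s (x + 2 * Real.pi)) = fun s => u s x :=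
      funext fun s => hu.periodic s x
    simp only [_root_.pt, h]

theorem SmoothPer.px (hu : SmoothPer u) : SmoothPer (px u) where
  smooth := hu.smooth.px
  periodic t x := by
    have h : (fun y => u t (y + 2 * Real.pi)) = fun y => u t y :=
      funext fun y => hu.periodic t y
    simp only [_root_.px]
    rw [← deriv_comp_add_const, h]

theorem SmoothPer.add (hu : SmoothPer u) (hv : SmoothPer v) :
    SmoothPer fun t x => u t x + v t x where
  smooth := hu.smooth.add hv.smooth
  periodic t x := by simp only [hu.periodic t x, hv.periodic t x]

theorem SmoothPer.sub (hu : SmoothPer u) (hv : SmoothPer v) :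
    SmoothPer fun t x => u t x - v t x where
  smooth := hu.smooth.sub hv.smooth
  periodic t x := by simp only [hu.periodic t x, hv.periodic t x]

theorem SmoothPer.mul (hu : SmoothPer u) (hv : SmoothPer v) :
    SmoothPer fun t x => u t x * v t x where
  smooth := hu.smooth.mul hv.smooth
  periodic t x := by simp only [hu.periodic t x, hv.periodic t x]

theorem SmoothPer.neg (hu : SmoothPer u) : SmoothPer fun t x => -u t x where
  smooth := hu.smooth.neg
  periodic t x := by simp only [hu.periodic t x]

theorem SmoothPer.exp (hu : SmoothPer u) : SmoothPer fun t x => Real.exp (u t x) where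
  smooth := hu.smooth.exp
  periodic t x := by simp only [hu.periodic t x]

theorem smoothPer_time : SmoothPer fun t _ => t where
  smooth := contDiff_fst
  periodic _ _ := rfl

theorem smoothPer_const (r : ℝ) : SmoothPer fun _ _ => r where
  smooth := contDiff_const
  periodic _ _ := rfl

theorem smoothPer_space {g : ℝ → ℝ} (hg : ContDiff ℝ (⊤ : ℕ∞) g)
    (hp : Function.Periodic g (2 * Real.pi)) : SmoothPer fun _ x => g x where
  smooth := hg.comp contDiff_snd
  periodic _ x := hp x

end Calculus

section Pullback

instance fact_two_pi_pos : Fact (0 < 2 * Real.pi) := ⟨Real.two_pi_pos⟩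

/-- The compact cylinder `[0,1] × S¹`. -/
abbrev Cyl : Type := unitInterval × AddCircle (2 * Real.pi)

variable {h : ℝ → ℝ → ℝ}

/-- A function on `ℝ × S¹` induced by a function on the plane that is periodic in the second
variable. -/
def descend (hh : SmoothPer h) (q : ℝ × AddCircle (2 * Real.pi)) : ℝ :=
  Function.Periodic.lift (f := h q.1) (c := 2 * Real.pi) (fun x => hh.periodic q.1 x) q.2

theorem continuous_descend (hh : SmoothPer h) : Continuous (descend hh) := by
  have hq : IsOpenQuotientMap
      (Prod.map id (QuotientAddGroup.mk : ℝ → AddCircle (2 * Real.pi)) : ℝ × ℝ → _) :=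
    IsOpenQuotientMap.id.prodMap QuotientAddGroup.isOpenQuotientMap_mk
  rw [← hq.continuous_comp_iff]
  exact hh.smooth.continuous

/-- The family, continuous in `(τ, y)`, of functions `(σ, ξ) ↦ h (τ σ) (y + ξ)` on the
cylinder. -/
def pull (hh : SmoothPer h) : C(ℝ × ℝ, C(Cyl, ℝ)) :=
  ContinuousMap.curry
    ⟨fun q => descend hh (q.1.1 * q.2.1, (q.1.2 : AddCircle (2 * Real.pi)) + q.2.2), by
      refine (continuous_descend hh).comp (.prodMk (by fun_prop)
        (Continuous.add (f := fun q : (ℝ × ℝ) × Cyl => (q.1.2 : AddCircle (2 * Real.pi))) ?_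
          (continuous_snd.comp continuous_snd)))
      exact (AddCircle.continuous_mk' _).comp (by fun_prop)⟩

@[simp]
theorem pull_apply (hh : SmoothPer h) (τ y x : ℝ) (σ : unitInterval) :
    pull hh (τ, y) (σ, (x : AddCircle (2 * Real.pi))) = h (τ * σ) (y + x) := rfl

theorem Cyl.ext_coe {f g : C(Cyl, ℝ)}
    (H : ∀ (σ : unitInterval) (x : ℝ), f (σ, (x : AddCircle (2 * Real.pi))) = g (σ, ↑x)) :
    f = g := by
  ext ⟨σ, ξ⟩
  induction ξ using QuotientAddGroup.induction_on with
  | H x => exact H σ x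

/-- The coordinate `σ` on the cylinder. -/
def coordFst : C(Cyl, ℝ) := ⟨fun k => k.1, by fun_prop⟩

@[simp]
theorem coordFst_apply (k : Cyl) : coordFst k = k.1 := rfl

/-- The derivative of `pull`. -/
def pullDeriv (hh : SmoothPer h) (p : ℝ × ℝ) : ℝ × ℝ →L[ℝ] C(Cyl, ℝ) :=
  (ContinuousLinearMap.fst ℝ ℝ ℝ).smulRight (coordFst * pull hh.pt p) +
    (ContinuousLinearMap.snd ℝ ℝ ℝ).smulRight (pull hh.px p)

theorem hasFDerivAt_pull (hh : SmoothPer h) (p : ℝ × ℝ) :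
    HasFDerivAt (pull hh) (pullDeriv hh p) p := by
  have hcont : Continuous (pullDeriv hh) := by
    have h1 : Continuous fun q => coordFst * pull hh.pt q :=
      continuous_const.mul (pull hh.pt).continuous
    exact ((ContinuousLinearMap.smulRightL ℝ (ℝ × ℝ) C(Cyl, ℝ) _).continuous.comp h1).add
      ((ContinuousLinearMap.smulRightL ℝ (ℝ × ℝ) C(Cyl, ℝ) _).continuous.comp
        (pull hh.px).continuous)
  rw [hasFDerivAt_iff_isLittleO, Asymptotics.isLittleO_iff]
  intro ε hε
  obtain ⟨δ, hδ, hball⟩ := (Metric.continuousAt_iff (β := ℝ × ℝ →L[ℝ] C(Cyl, ℝ))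
    (f := pullDeriv hh) (a := p)).1 (by exact hcont.continuousAt) ε hε
  filter_upwards [Metric.ball_mem_nhds p hδ] with p' hp'
  rw [ContinuousMap.norm_le _ (by positivity)]
  rintro ⟨σ, ξ⟩
  induction ξ using QuotientAddGroup.induction_on with
  | H x =>
    let ev : C(Cyl, ℝ) →L[ℝ] ℝ := ContinuousMap.evalCLM ℝ (σ, (x : AddCircle (2 * Real.pi)))
    have hev : ‖ev‖ ≤ 1 := ev.opNorm_le_bound zero_le_one fun f => by
      rw [one_mul]; exact f.norm_coe_le_norm _
    have hderiv : ∀ z ∈ Metric.ball p δ, HasFDerivWithinAt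
        (fun z : ℝ × ℝ => ev (pull hh z)) (ev.comp (pullDeriv hh z)) (Metric.ball p δ) z := by
      rintro ⟨τ, y⟩ -
      refine HasFDerivAt.hasFDerivWithinAt ?_
      have h1 : HasFDerivAt (fun z : ℝ × ℝ => (z.1 * σ, z.2 + x))
          (((ContinuousLinearMap.fst ℝ ℝ ℝ).smulRight (σ : ℝ)).prod
            (ContinuousLinearMap.snd ℝ ℝ ℝ)) (τ, y) := by
        refine HasFDerivAt.prodMk ?_ (hasFDerivAt_snd.add_const x)
        exact (ContinuousLinearMap.hasFDerivAt
          ((ContinuousLinearMap.fst ℝ ℝ ℝ).smulRight (σ : ℝ)))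
      have h2 := (hh.smooth.hasFDerivAt (τ * σ, y + x)).comp (τ, y) h1
      have h3 : ev.comp (pullDeriv hh (τ, y)) =
          (fderiv ℝ (fun p : ℝ × ℝ => h p.1 p.2) (τ * σ, y + x)).comp
            (((ContinuousLinearMap.fst ℝ ℝ ℝ).smulRight (σ : ℝ)).prod
              (ContinuousLinearMap.snd ℝ ℝ ℝ)) := by
        ext <;> simp [ev, pullDeriv, hh.smooth.fderiv_apply]
      rw [h3]
      exact h2
    have hbound : ∀ z ∈ Metric.ball p δ,
        ‖ev.comp (pullDeriv hh z) - ev.comp (pullDeriv hh p)‖ ≤ ε := by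
      intro z hz
      rw [← ContinuousLinearMap.comp_sub]
      refine (ev.opNorm_comp_le _).trans ?_
      have : ‖pullDeriv hh z - pullDeriv hh p‖ ≤ ε :=
        (dist_eq_norm (pullDeriv hh z) _).symm.le.trans (hball hz).le
      nlinarith [norm_nonneg ev, norm_nonneg (pullDeriv hh z - pullDeriv hh p)]
    have := (convex_ball p δ).norm_image_sub_le_of_norm_hasFDerivWithin_le' hderiv hbound
      (Metric.mem_ball_self hδ) hp'
    simpa [ev] using this

theorem contDiff_pull_nat (n : ℕ) :
    ∀ {h : ℝ → ℝ → ℝ} (hh : SmoothPer h), ContDiff ℝ n (pull hh) := by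
  induction n with
  | zero => exact fun hh => contDiff_zero.2 (pull hh).continuous
  | succ n ih =>
    intro h hh
    push_cast
    rw [contDiff_succ_iff_hasFDerivAt]
    refine ⟨pullDeriv hh, ?_, hasFDerivAt_pull hh⟩
    exact (contDiff_const.smulRight (contDiff_const.mul (ih hh.pt))).add
      (contDiff_const.smulRight (ih hh.px))

theorem contDiff_pull (hh : SmoothPer h) : ContDiff ℝ (⊤ : ℕ∞) (pull hh) :=
  contDiff_infty.2 fun n => contDiff_pull_nat n hh

/-- The base point `(1, 0)` of the cylinder. -/
def basePoint : Cyl := (1, ((0 : ℝ) : AddCircle (2 * Real.pi)))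

theorem pull_basePoint (hh : SmoothPer h) (t x : ℝ) : pull hh (t, x) basePoint = h t x := by
  have := pull_apply hh t x 0 1
  rwa [Set.Icc.coe_one, mul_one, add_zero] at this

theorem pull_add_two_pi (hh : SmoothPer h) (t x : ℝ) :
    pull hh (t, x + 2 * Real.pi) = pull hh (t, x) :=
  Cyl.ext_coe fun σ y => by
    rw [pull_apply, pull_apply, add_right_comm, hh.periodic]

end Pullback

section Averages

/-- The contraction factor `exp (-|s|)` as a point of the unit interval. -/
def decay (s : ℝ) : unitInterval :=
  ⟨Real.exp (-|s|), (Real.exp_pos _).le, Real.exp_le_one_iff.2 (by simp)⟩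

theorem continuous_decay : Continuous decay := by
  unfold decay
  fun_prop

theorem coe_decay_of_pos {s : ℝ} (hs : 0 < s) : (decay s : ℝ) = Real.exp (-s) := by
  simp [decay, abs_of_pos hs]

variable {μ : ℝ} (κ : ℝ)

/-- The integrand of `cylAverage`. -/
def cylIntegrand (μ κ : ℝ) (V : C(Cyl, ℝ)) (k : Cyl) (s : ℝ) : ℝ :=
  Real.exp (-μ * s) * V (k.1 * decay s, k.2 + ((κ * s : ℝ) : AddCircle (2 * Real.pi)))

theorem continuous_cylIntegrand (μ κ : ℝ) (V : C(Cyl, ℝ)) :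
    Continuous fun q : Cyl × ℝ => cylIntegrand μ κ V q.1 q.2 := by
  unfold cylIntegrand
  refine Continuous.mul (by fun_prop) (V.continuous.comp (.prodMk ?_ ?_))
  · exact (continuous_fst.comp continuous_fst).mul (continuous_decay.comp continuous_snd)
  · exact (continuous_snd.comp continuous_fst).add
      ((AddCircle.continuous_mk' _).comp (continuous_const.mul continuous_snd))

theorem norm_cylIntegrand_le (V : C(Cyl, ℝ)) {A : ℝ} {n : ℕ}
    (hV : ∀ k, |V k| ≤ A * (k.1 : ℝ) ^ n) (k : Cyl) {s : ℝ} (hs : 0 < s) :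
    ‖cylIntegrand μ κ V k s‖ ≤ Real.exp (-(μ + n) * s) * (A * (k.1 : ℝ) ^ n) := by
  have h1 := hV (k.1 * decay s, k.2 + ((κ * s : ℝ) : AddCircle (2 * Real.pi)))
  have h2 : Real.exp (-(μ + n) * s) = Real.exp (-μ * s) * Real.exp (-s) ^ n := by
    rw [← Real.exp_nat_mul, ← Real.exp_add]
    congr 1
    ring
  rw [cylIntegrand, norm_mul, Real.norm_eq_abs, Real.norm_eq_abs, Real.abs_exp, h2, mul_assoc]
  refine mul_le_mul_of_nonneg_left (h1.trans (le_of_eq ?_)) (Real.exp_pos _).le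
  rw [Set.Icc.coe_mul, coe_decay_of_pos hs, mul_pow]
  ring

theorem integrableOn_cylIntegrand (hμ : 0 < μ) (V : C(Cyl, ℝ)) (k : Cyl) :
    IntegrableOn (cylIntegrand μ κ V k) (Ioi 0) := by
  have hi := (integrableOn_exp_mul_Ioi (neg_lt_zero.2 hμ) 0).mul_const ‖V‖
  refine Integrable.mono' hi ?_ ?_
  · exact ((continuous_cylIntegrand μ κ V).comp (Continuous.prodMk_right k)).aestronglyMeasurable
  · filter_upwards [ae_restrict_mem measurableSet_Ioi] with s hs
    simpa using norm_cylIntegrand_le (μ := μ) κ V (A := ‖V‖) (n := 0)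
      (fun k => by simpa using V.norm_coe_le_norm k) k hs

theorem abs_integral_cylIntegrand_le (hμ : 0 < μ) (V : C(Cyl, ℝ)) {A : ℝ} {n : ℕ}
    (hV : ∀ k, |V k| ≤ A * (k.1 : ℝ) ^ n) (k : Cyl) :
    |∫ s in Ioi (0 : ℝ), cylIntegrand μ κ V k s| ≤ A / (μ + n) * (k.1 : ℝ) ^ n := by
  have hμn : -(μ + n) < 0 := by
    have : (0 : ℝ) ≤ n := n.cast_nonneg
    linarith
  have hi := (integrableOn_exp_mul_Ioi hμn 0).mul_const (A * (k.1 : ℝ) ^ n)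
  have hb := norm_integral_le_of_norm_le hi (f := cylIntegrand μ κ V k) (by
    filter_upwards [ae_restrict_mem measurableSet_Ioi] with s hs
    exact norm_cylIntegrand_le κ V hV k hs)
  rw [integral_mul_const, integral_exp_mul_Ioi hμn] at hb
  refine hb.trans (le_of_eq ?_)
  rw [mul_zero, Real.exp_zero, neg_div_neg_eq]
  ring

/-- The operator `V ↦ ∫₀^∞ exp (-μ s) V (σ exp (-s), ξ + κ s) ds` on continuous functions on the
cylinder. -/
def cylAverage (hμ : 0 < μ) : C(Cyl, ℝ) →L[ℝ] C(Cyl, ℝ) :=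
  LinearMap.mkContinuous
    { toFun := fun V => ⟨fun k => ∫ s in Ioi (0 : ℝ), cylIntegrand μ κ V k s, by
        refine continuous_of_dominated (bound := fun s => Real.exp (-μ * s) * ‖V‖) ?_ ?_ ?_ ?_
        · exact fun k => (integrableOn_cylIntegrand κ hμ V k).aestronglyMeasurable
        · intro k
          filter_upwards [ae_restrict_mem measurableSet_Ioi] with s hs
          simpa using norm_cylIntegrand_le (μ := μ) κ V (A := ‖V‖) (n := 0)
            (fun k => by simpa using V.norm_coe_le_norm k) k hs
        · exact (integrableOn_exp_mul_Ioi (neg_lt_zero.2 hμ) 0).mul_const ‖V‖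
        · exact .of_forall fun s =>
            (continuous_cylIntegrand μ κ V).comp (Continuous.prodMk_left s)⟩
      map_add' := fun V W => by
        ext k
        simp only [ContinuousMap.coe_mk, ContinuousMap.add_apply]
        rw [← integral_add (integrableOn_cylIntegrand κ hμ V k)
          (integrableOn_cylIntegrand κ hμ W k)]
        congr 1 with s
        simp only [cylIntegrand, ContinuousMap.add_apply]
        ring
      map_smul' := fun r V => by
        ext k
        simp only [ContinuousMap.coe_mk, ContinuousMap.smul_apply, RingHom.id_apply, smul_eq_mul]
        rw [← integral_const_mul]
        congr 1 with s
        simp only [cylIntegrand, ContinuousMap.smul_apply, smul_eq_mul]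
        ring }
    μ⁻¹ fun V => by
      rw [ContinuousMap.norm_le _ (by positivity)]
      intro k
      have := abs_integral_cylIntegrand_le κ hμ V (A := ‖V‖) (n := 0)
        (fun k => by simpa using V.norm_coe_le_norm k) k
      rw [inv_mul_eq_div]
      simpa using this

theorem cylAverage_apply (hμ : 0 < μ) (V : C(Cyl, ℝ)) (k : Cyl) :
    cylAverage κ hμ V k = ∫ s in Ioi (0 : ℝ), cylIntegrand μ κ V k s := rfl

theorem abs_cylAverage_le (hμ : 0 < μ) (V : C(Cyl, ℝ)) {A : ℝ} {n : ℕ}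
    (hV : ∀ k, |V k| ≤ A * (k.1 : ℝ) ^ n) (k : Cyl) :
    |cylAverage κ hμ V k| ≤ A / (μ + n) * (k.1 : ℝ) ^ n :=
  abs_integral_cylIntegrand_le κ hμ V hV k

/-- The average of a function along the flow `(t, x) ↦ (t exp (-s), x + κ s)` with weight
`exp (-μ s)`. -/
def average (μ κ : ℝ) (F : ℝ → ℝ → ℝ) : ℝ → ℝ → ℝ := fun t x =>
  ∫ s in Ioi (0 : ℝ), Real.exp (-μ * s) * F (t * Real.exp (-s)) (x + κ * s)

variable {F q : ℝ → ℝ → ℝ}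

theorem cylIntegrand_pull (hF : SmoothPer F) (τ y x : ℝ) (σ : unitInterval) {s : ℝ} (hs : 0 < s) :
    cylIntegrand μ κ (pull hF (τ, y)) (σ, (x : AddCircle (2 * Real.pi))) s =
      Real.exp (-μ * s) * F (τ * σ * Real.exp (-s)) (y + x + κ * s) := by
  rw [cylIntegrand, ← AddCircle.coe_add, pull_apply, Set.Icc.coe_mul, coe_decay_of_pos hs,
    mul_assoc τ, add_assoc y]

theorem cylAverage_pull (hμ : 0 < μ) (hF : SmoothPer F) (τ y x : ℝ) (σ : unitInterval) :
    cylAverage κ hμ (pull hF (τ, y)) (σ, (x : AddCircle (2 * Real.pi))) =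
      average μ κ F (τ * σ) (y + x) := by
  rw [cylAverage_apply, average]
  refine setIntegral_congr_fun measurableSet_Ioi fun s hs => ?_
  exact cylIntegrand_pull κ hF τ y x σ hs

theorem cylAverage_pull_basePoint (hμ : 0 < μ) (hF : SmoothPer F) (t x : ℝ) :
    cylAverage κ hμ (pull hF (t, x)) basePoint = average μ κ F t x := by
  have := cylAverage_pull κ hμ hF t x 0 1
  rwa [Set.Icc.coe_one, mul_one, add_zero] at this

theorem smoothPer_average (hμ : 0 < μ) (hF : SmoothPer F) : SmoothPer (average μ κ F) where
  smooth := by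
    have h : (fun p : ℝ × ℝ => average μ κ F p.1 p.2) = fun p =>
        ContinuousMap.evalCLM ℝ basePoint (cylAverage κ hμ (pull hF p)) := by
      ext p; exact (cylAverage_pull_basePoint κ hμ hF p.1 p.2).symm
    unfold Smooth2
    rw [h]
    exact (ContinuousLinearMap.contDiff _).comp
      ((ContinuousLinearMap.contDiff _).comp (contDiff_pull hF))
  periodic t x := by
    rw [← cylAverage_pull_basePoint κ hμ hF, pull_add_two_pi, cylAverage_pull_basePoint]

theorem integrableOn_average (hμ : 0 < μ) (hF : SmoothPer F) (t x a : ℝ) :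
    IntegrableOn (fun s => Real.exp (-μ * s) * F (t * Real.exp (-s)) (x + κ * s)) (Ioi a) := by
  have hi := (integrableOn_exp_mul_Ioi (neg_lt_zero.2 hμ) a).mul_const
    ‖pull hF (t * Real.exp (-a), 0)‖
  refine Integrable.mono' hi ?_ ?_
  · refine Continuous.aestronglyMeasurable (Continuous.mul (by fun_prop) ?_)
    exact hF.smooth.continuous.comp (.prodMk (by fun_prop) (by fun_prop))
  · filter_upwards [ae_restrict_mem measurableSet_Ioi] with s hs
    rw [norm_mul, Real.norm_of_nonneg (Real.exp_pos _).le]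
    refine mul_le_mul_of_nonneg_left ?_ (Real.exp_pos _).le
    have h := (pull hF (t * Real.exp (-a), 0)).norm_coe_le_norm
      (decay (s - a), ((x + κ * s : ℝ) : AddCircle (2 * Real.pi)))
    rw [pull_apply, coe_decay_of_pos (sub_pos.2 hs), zero_add, mul_assoc, ← Real.exp_add] at h
    rwa [show -a + -(s - a) = -s by ring] at h

theorem hasDerivAt_integral_Ioi {g : ℝ → ℝ} (hg : Continuous g)
    (hi : ∀ a, IntegrableOn g (Ioi a)) (s : ℝ) :
    HasDerivAt (fun s => ∫ r in Ioi s, g r) (-g s) s := by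
  have h : (fun s => ∫ r in Ioi s, g r) = fun u => (∫ r in Ioi s, g r) - ∫ r in s..u, g r := by
    ext u
    have := intervalIntegral.integral_interval_add_Ioi (hi s) (hi u)
    linarith
  rw [h]
  simpa using ((hg.integral_hasStrictDerivAt s s).hasDerivAt).const_sub (∫ r in Ioi s, g r)

theorem integral_Ioi_zero_comp_add (g : ℝ → ℝ) (s : ℝ) :
    ∫ r in Ioi (0 : ℝ), g (s + r) = ∫ r in Ioi s, g r := by
  have h := (measurePreserving_add_left volume s).setIntegral_preimage_emb
    (measurableEmbedding_addLeft s) g (Ioi s)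
  rw [← h]
  congr 2
  ext r
  simp

/-- The average of `F` solves the transport equation `t ∂ₜq - κ ∂ₓq + μ q = F`. -/
theorem transport_average (hμ : 0 < μ) (hF : SmoothPer F) (t x : ℝ) :
    t * pt (average μ κ F) t x - κ * px (average μ κ F) t x + μ * average μ κ F t x = F t x := by
  set g : ℝ → ℝ := fun s => Real.exp (-μ * s) * F (t * Real.exp (-s)) (x + κ * s) with hg
  have hgc : Continuous g := Continuous.mul (by fun_prop)
    (hF.smooth.continuous.comp (.prodMk (by fun_prop) (by fun_prop)))
  have h1 : (fun s => Real.exp (-μ * s) * average μ κ F (t * Real.exp (-s)) (x + κ * s)) =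
      fun s => ∫ r in Ioi s, g r := by
    ext s
    rw [← integral_Ioi_zero_comp_add g s, average, ← integral_const_mul]
    congr 1 with r
    rw [hg]
    dsimp only
    rw [← mul_assoc, ← Real.exp_add, mul_assoc t, ← Real.exp_add]
    ring_nf
  have h2 := hasDerivAt_integral_Ioi hgc (integrableOn_average κ hμ hF t x) 0
  rw [← h1] at h2
  have hexp : ∀ c : ℝ, HasDerivAt (fun s => Real.exp (c * s)) c 0 := fun c => by
    simpa using ((hasDerivAt_id (0 : ℝ)).const_mul c).exp
  have hT : HasDerivAt (fun s : ℝ => t * Real.exp (-s)) (-t) 0 := by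
    simpa using (hexp (-1)).const_mul t
  have hX : HasDerivAt (fun s : ℝ => x + κ * s) κ 0 := by
    simpa using ((hasDerivAt_id (0 : ℝ)).const_mul κ).const_add x
  have h3 := (hexp (-μ)).mul ((smoothPer_average κ hμ hF).smooth.hasDerivAt_curve hT hX)
  have h4 := h3.unique h2
  simp [hg] at h4
  linarith

/-- A solution of the transport equation along one characteristic is given by the average. -/
theorem eq_average_of_transport (hμ : 0 < μ) (hF : SmoothPer F) (hq : SmoothPer q) (t x : ℝ)
    (H : ∀ s, 0 < s → t * Real.exp (-s) * pt q (t * Real.exp (-s)) (x + κ * s)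
      - κ * px q (t * Real.exp (-s)) (x + κ * s) + μ * q (t * Real.exp (-s)) (x + κ * s)
        = F (t * Real.exp (-s)) (x + κ * s)) :
    q t x = average μ κ F t x := by
  have hexp : ∀ c s : ℝ, HasDerivAt (fun s => Real.exp (c * s)) (c * Real.exp (c * s)) s :=
    fun c s => by
      simpa [mul_comm] using ((hasDerivAt_id s).const_mul c).exp
  have hT : ∀ s, HasDerivAt (fun s : ℝ => t * Real.exp (-s)) (-(t * Real.exp (-s))) s :=
    fun s => by simpa using (hexp (-1) s).const_mul t
  have hX : ∀ s, HasDerivAt (fun s : ℝ => x + κ * s) κ s := fun s => by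
    simpa using ((hasDerivAt_id s).const_mul κ).const_add x
  have hd := fun s => (hexp (-μ) s).mul (hq.smooth.hasDerivAt_curve (hT s) (hX s))
  have hF' := (integrableOn_average κ hμ hF t x 0).neg
  have hlim : Tendsto (fun s => Real.exp (-μ * s) * q (t * Real.exp (-s)) (x + κ * s)) atTop
      (𝓝 0) := by
    have h0 : Tendsto (fun s => Real.exp (-μ * s)) atTop (𝓝 0) :=
      Real.tendsto_exp_atBot.comp (tendsto_id.const_mul_atTop_of_neg (neg_lt_zero.2 hμ))
    refine h0.zero_mul_isBoundedUnder_le ⟨‖pull hq (t, 0)‖, ?_⟩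
    rw [eventually_map]
    filter_upwards [eventually_gt_atTop 0] with s hs
    have h := (pull hq (t, 0)).norm_coe_le_norm
      (decay s, ((x + κ * s : ℝ) : AddCircle (2 * Real.pi)))
    rwa [pull_apply, coe_decay_of_pos hs, zero_add] at h
  have := integral_Ioi_of_hasDerivAt_of_tendsto
    (f' := fun s => -(Real.exp (-μ * s) * F (t * Real.exp (-s)) (x + κ * s)))
    (hd 0).continuousAt.continuousWithinAt
    (fun s hs => by
      rw [← H s hs]
      exact (hd s).congr_deriv (by ring)) hF' hlim
  rw [integral_neg] at this
  rw [average]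
  simp at this ⊢
  linarith

/-- The derivative of `t ↦ t · average 1 0 F` is `F`. -/
theorem average_add_pt_average (hF : SmoothPer F) (t x : ℝ) :
    average 1 0 F t x + t * pt (average 1 0 F) t x = F t x := by
  have := transport_average (μ := 1) 0 one_pos hF t x
  linarith

theorem hasDerivAt_mul_average (hF : SmoothPer F) (t x : ℝ) :
    HasDerivAt (fun s => s * average 1 0 F s x) (F t x) t := by
  have h := (hasDerivAt_id t).mul
    ((smoothPer_average (μ := 1) 0 one_pos hF).smooth.hasDerivAt_fst t x)
  refine h.congr_deriv ?_
  rw [← average_add_pt_average hF, one_mul, id]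

/-- Hadamard's lemma in the time variable. -/
theorem eq_add_mul_average_pt (hF : SmoothPer F) (t x : ℝ) :
    F t x = F 0 x + t * average 1 0 (pt F) t x := by
  have h : ∀ s, HasDerivAt (fun s => F s x - s * average 1 0 (pt F) s x) 0 s := fun s => by
    exact ((hF.smooth.hasDerivAt_fst s x).sub (hasDerivAt_mul_average hF.pt s x)).congr_deriv
      (sub_self _)
  have := is_const_of_deriv_eq_zero (fun s => (h s).differentiableAt) (fun s => (h s).deriv) t 0
  simp only [zero_mul, sub_zero] at this
  linarith

end Averages

section NormedSpace

variable {E : Type*} [NormedAddCommGroup E] [NormedSpace ℝ E]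

theorem contDiff_fst_smul_comp {B : ℝ × ℝ → E →L[ℝ] E} (S M : E →L[ℝ] E)
    (hB : ContDiff ℝ (⊤ : ℕ∞) B) :
    ContDiff ℝ (⊤ : ℕ∞) fun p : ℝ × ℝ => p.1 • S.comp (M.comp (B p)) :=
  contDiff_fst.smul (contDiff_const.clm_comp (contDiff_const.clm_comp hB))

variable [CompleteSpace E]

theorem isUnit_one_add_of_norm_pow_lt_one {K : E →L[ℝ] E} {n : ℕ} (hn : ‖K ^ n‖ < 1) :
    IsUnit (1 + K) := by
  have hlt : ‖(-K) ^ n‖ < 1 := by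
    rcases Nat.even_or_odd n with h | h
    · rwa [h.neg_pow]
    · rwa [h.neg_pow, norm_neg]
  have h1 := isUnit_one_sub_of_norm_lt_one hlt
  rw [← mul_neg_geom_sum] at h1
  have hcomm : Commute (1 - -K) (∑ i ∈ Finset.range n, (-K) ^ i) := by
    rw [Commute, SemiconjBy, mul_neg_geom_sum, geom_sum_mul_neg]
  have := (hcomm.isUnit_mul_iff.1 h1).1
  rwa [sub_neg_eq_add] at this

theorem contDiff_inverse_one_add_apply {K : ℝ × ℝ → E →L[ℝ] E} {V : ℝ × ℝ → E}
    (hK : ContDiff ℝ (⊤ : ℕ∞) K) (hV : ContDiff ℝ (⊤ : ℕ∞) V) (hu : ∀ p, IsUnit (1 + K p)) :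
    ContDiff ℝ (⊤ : ℕ∞) fun p => Ring.inverse (1 + K p) (V p) := by
  refine ContDiff.clm_apply (contDiff_iff_contDiffAt.2 fun p => ?_) hV
  obtain ⟨U, hU⟩ := hu p
  have h1 := contDiffAt_ringInverse (n := (⊤ : ℕ∞)) ℝ U
  rw [hU] at h1
  exact h1.comp p (contDiff_const.add hK).contDiffAt

end NormedSpace

section Volterra

variable {μ : ℝ} {g γ h w q : ℝ → ℝ → ℝ}

/-- The Volterra operator `V ↦ τ S (σ (g V + γ A V))` on the cylinder, where `S` and `A` are the
averages with parameters `(μ, 2)` and `(1, 0)` and where `g`, `γ` are pulled back along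
`p = (τ, y)`. -/
def volterra (hμ : 0 < μ) (hg : SmoothPer g) (hγ : SmoothPer γ) (p : ℝ × ℝ) :
    C(Cyl, ℝ) →L[ℝ] C(Cyl, ℝ) :=
  p.1 • (cylAverage 2 hμ).comp ((ContinuousLinearMap.mul ℝ C(Cyl, ℝ) coordFst).comp
    (ContinuousLinearMap.mul ℝ C(Cyl, ℝ) (pull hg p) +
      (ContinuousLinearMap.mul ℝ C(Cyl, ℝ) (pull hγ p)).comp (cylAverage 0 one_pos)))

theorem volterra_apply (hμ : 0 < μ) (hg : SmoothPer g) (hγ : SmoothPer γ) (p : ℝ × ℝ)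
    (V : C(Cyl, ℝ)) :
    volterra hμ hg hγ p V = p.1 • cylAverage 2 hμ
      (coordFst * (pull hg p * V + pull hγ p * cylAverage 0 one_pos V)) := rfl

theorem contDiff_volterra (hμ : 0 < μ) (hg : SmoothPer g) (hγ : SmoothPer γ) :
    ContDiff ℝ (⊤ : ℕ∞) (volterra hμ hg hγ) := by
  refine contDiff_fst_smul_comp (E := C(Cyl, ℝ)) _ _ ?_
  exact ((ContinuousLinearMap.contDiff _).comp (contDiff_pull hg)).add
    (((ContinuousLinearMap.contDiff _).comp (contDiff_pull hγ)).clm_comp contDiff_const)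

theorem abs_volterra_le (hμ : 0 < μ) (hg : SmoothPer g) (hγ : SmoothPer γ) (p : ℝ × ℝ)
    (V : C(Cyl, ℝ)) {A : ℝ} (hA : 0 ≤ A) {n : ℕ} (hV : ∀ k, |V k| ≤ A * (k.1 : ℝ) ^ n) (k : Cyl) :
    |volterra hμ hg hγ p V k| ≤
      |p.1| * (‖pull hg p‖ + ‖pull hγ p‖) * A / (n + 1) * (k.1 : ℝ) ^ (n + 1) := by
  have hn : (0 : ℝ) ≤ n := n.cast_nonneg
  set B := ‖pull hg p‖ + ‖pull hγ p‖ with hB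
  have h1 : ∀ k : Cyl, |(coordFst * (pull hg p * V + pull hγ p * cylAverage 0 one_pos V)) k| ≤
      B * A * (k.1 : ℝ) ^ (n + 1) := by
    intro k
    have hk : (0 : ℝ) ≤ k.1 := k.1.2.1
    have h2 : |cylAverage 0 one_pos V k| ≤ A * (k.1 : ℝ) ^ n :=
      (abs_cylAverage_le 0 one_pos V hV k).trans
        (mul_le_mul_of_nonneg_right (div_le_self hA (by linarith)) (by positivity))
    have h3 : |pull hg p k| ≤ ‖pull hg p‖ := (pull hg p).norm_coe_le_norm k
    have h4 : |pull hγ p k| ≤ ‖pull hγ p‖ := (pull hγ p).norm_coe_le_norm k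
    simp only [ContinuousMap.mul_apply, ContinuousMap.add_apply, coordFst_apply]
    rw [abs_mul, abs_of_nonneg hk]
    calc (k.1 : ℝ) * |pull hg p k * V k + pull hγ p k * cylAverage 0 one_pos V k|
        ≤ (k.1 : ℝ) * (‖pull hg p‖ * (A * (k.1 : ℝ) ^ n) + ‖pull hγ p‖ * (A * (k.1 : ℝ) ^ n)) := by
          refine mul_le_mul_of_nonneg_left ((abs_add_le _ _).trans ?_) hk
          rw [abs_mul, abs_mul]
          gcongr
          exact hV k
      _ = B * A * (k.1 : ℝ) ^ (n + 1) := by rw [hB]; ring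
  have h5 := abs_cylAverage_le 2 hμ _ h1 k
  have hk : (0 : ℝ) ≤ k.1 := k.1.2.1
  rw [volterra_apply, ContinuousMap.smul_apply, smul_eq_mul, abs_mul]
  calc |p.1| * _ ≤ |p.1| * (B * A / (n + 1) * (k.1 : ℝ) ^ (n + 1)) := by
        refine mul_le_mul_of_nonneg_left (h5.trans ?_) (abs_nonneg _)
        exact mul_le_mul_of_nonneg_right (div_le_div_of_nonneg_left (by positivity)
          (by positivity) (by push_cast; linarith)) (by positivity)
    _ = _ := by ring

theorem isUnit_one_add_volterra (hμ : 0 < μ) (hg : SmoothPer g) (hγ : SmoothPer γ) (p : ℝ × ℝ) :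
    IsUnit (1 + volterra hμ hg hγ p) := by
  set K := volterra hμ hg hγ p with hK
  set C := |p.1| * (‖pull hg p‖ + ‖pull hγ p‖) with hC
  have hC0 : 0 ≤ C := by positivity
  have hpow : ∀ (n : ℕ) (V : C(Cyl, ℝ)) (k : Cyl),
      |(K ^ n) V k| ≤ C ^ n / n.factorial * ‖V‖ * (k.1 : ℝ) ^ n := by
    intro n V
    induction n with
    | zero => intro k; simpa using V.norm_coe_le_norm k
    | succ n ih =>
      intro k
      rw [pow_succ']
      change |K ((K ^ n) V) k| ≤ _
      refine (abs_volterra_le hμ hg hγ p _ (by positivity) ih k).trans (le_of_eq ?_)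
      rw [← hC, Nat.factorial_succ]
      push_cast
      field_simp
      ring
  have hnorm : ∀ n : ℕ, ‖K ^ n‖ ≤ C ^ n / n.factorial := fun n => by
    refine ContinuousLinearMap.opNorm_le_bound _ (by positivity) fun V => ?_
    rw [ContinuousMap.norm_le _ (by positivity)]
    intro k
    refine (hpow n V k).trans (mul_le_of_le_one_right (by positivity) ?_)
    exact pow_le_one₀ k.1.2.1 k.1.2.2
  obtain ⟨n, hn⟩ := ((FloorSemiring.tendsto_pow_div_factorial_atTop C).eventually
    (gt_mem_nhds one_pos)).exists
  exact isUnit_one_add_of_norm_pow_lt_one (E := C(Cyl, ℝ)) ((hnorm n).trans_lt hn)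

theorem eq_of_add_volterra_eq (hμ : 0 < μ) (hg : SmoothPer g) (hγ : SmoothPer γ) {p : ℝ × ℝ}
    {V W : C(Cyl, ℝ)} (H : V + volterra hμ hg hγ p V = W + volterra hμ hg hγ p W) : V = W := by
  have h := Ring.inverse_mul_cancel _ (isUnit_one_add_volterra hμ hg hγ p)
  have h1 : ∀ U : C(Cyl, ℝ),
      Ring.inverse (1 + volterra hμ hg hγ p) (U + volterra hμ hg hγ p U) = U := fun U =>
    congrArg (fun T : C(Cyl, ℝ) →L[ℝ] C(Cyl, ℝ) => T U) h
  rw [← h1 V, H, h1 W]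

/-- The right-hand side `t (g w + γ A w)` whose average is `volterra` applied to `w`. -/
def lowerOrder (g γ w : ℝ → ℝ → ℝ) : ℝ → ℝ → ℝ := fun t x =>
  t * (g t x * w t x + γ t x * average 1 0 w t x)

theorem smoothPer_lowerOrder (hg : SmoothPer g) (hγ : SmoothPer γ) (hw : SmoothPer w) :
    SmoothPer (lowerOrder g γ w) :=
  smoothPer_time.mul ((hg.mul hw).add (hγ.mul (smoothPer_average 0 one_pos hw)))

theorem volterra_pull (hμ : 0 < μ) (hg : SmoothPer g) (hγ : SmoothPer γ) (hw : SmoothPer w)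
    (p : ℝ × ℝ) :
    volterra hμ hg hγ p (pull hw p) =
      cylAverage 2 hμ (pull (smoothPer_lowerOrder hg hγ hw) p) := by
  rw [volterra_apply, ← map_smul]
  congr 1
  refine Cyl.ext_coe fun σ x => ?_
  obtain ⟨τ, y⟩ := p
  simp only [ContinuousMap.smul_apply, ContinuousMap.mul_apply, ContinuousMap.add_apply,
    coordFst_apply, pull_apply, cylAverage_pull, lowerOrder, smul_eq_mul]
  ring

/-- Pullback of functions on the cylinder along `(σ, ξ) ↦ (σ₀ σ, x₀ + ξ)`. -/
def rescale (σ₀ : unitInterval) (x₀ : ℝ) (V : C(Cyl, ℝ)) : C(Cyl, ℝ) :=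
  V.comp ⟨fun k => (σ₀ * k.1, (x₀ : AddCircle (2 * Real.pi)) + k.2),
    (continuous_const.mul continuous_fst).prodMk (Continuous.add
      (f := fun _ : Cyl => (x₀ : AddCircle (2 * Real.pi))) continuous_const continuous_snd)⟩

theorem rescale_apply (σ₀ : unitInterval) (x₀ : ℝ) (V : C(Cyl, ℝ)) (k : Cyl) :
    rescale σ₀ x₀ V k = V (σ₀ * k.1, (x₀ : AddCircle (2 * Real.pi)) + k.2) := rfl

theorem rescale_cylAverage (κ : ℝ) (hμ : 0 < μ) (σ₀ : unitInterval) (x₀ : ℝ) (V : C(Cyl, ℝ)) :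
    rescale σ₀ x₀ (cylAverage κ hμ V) = cylAverage κ hμ (rescale σ₀ x₀ V) := by
  ext k
  rw [rescale_apply, cylAverage_apply, cylAverage_apply]
  simp only [cylIntegrand, rescale_apply, mul_assoc, add_assoc]

theorem rescale_pull (hh : SmoothPer h) (σ₀ : unitInterval) (x₀ τ y : ℝ) :
    rescale σ₀ x₀ (pull hh (τ, y)) = pull hh (τ * σ₀, y + x₀) :=
  Cyl.ext_coe fun σ x => by
    rw [rescale_apply, ← AddCircle.coe_add, pull_apply, pull_apply, Set.Icc.coe_mul, mul_assoc,
      add_assoc]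

theorem rescale_volterra (hμ : 0 < μ) (hg : SmoothPer g) (hγ : SmoothPer γ)
    (σ₀ : unitInterval) (x₀ τ y : ℝ) (V : C(Cyl, ℝ)) :
    rescale σ₀ x₀ (volterra hμ hg hγ (τ, y) V) =
      volterra hμ hg hγ (τ * σ₀, y + x₀) (rescale σ₀ x₀ V) := by
  rw [volterra_apply, volterra_apply, ← map_smul, ← map_smul, rescale_cylAverage]
  congr 1
  rw [← rescale_pull, ← rescale_pull, ← rescale_cylAverage]
  ext k
  simp only [rescale_apply, ContinuousMap.smul_apply, ContinuousMap.mul_apply,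
    ContinuousMap.add_apply, coordFst_apply, smul_eq_mul, Set.Icc.coe_mul]
  ring

/-- The solution `V` of `V + volterra V = S h` on the cylinder with parameter `p`. -/
def resolvent (hμ : 0 < μ) (hg : SmoothPer g) (hγ : SmoothPer γ) (hh : SmoothPer h)
    (p : ℝ × ℝ) : C(Cyl, ℝ) :=
  Ring.inverse (1 + volterra hμ hg hγ p) (cylAverage 2 hμ (pull hh p))

theorem resolvent_add_volterra (hμ : 0 < μ) (hg : SmoothPer g) (hγ : SmoothPer γ)
    (hh : SmoothPer h) (p : ℝ × ℝ) :
    resolvent hμ hg hγ hh p + volterra hμ hg hγ p (resolvent hμ hg hγ hh p) =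
      cylAverage 2 hμ (pull hh p) :=
  congrArg (fun T : C(Cyl, ℝ) →L[ℝ] C(Cyl, ℝ) => T (cylAverage 2 hμ (pull hh p)))
    (Ring.mul_inverse_cancel _ (isUnit_one_add_volterra hμ hg hγ p))

theorem contDiff_resolvent (hμ : 0 < μ) (hg : SmoothPer g) (hγ : SmoothPer γ)
    (hh : SmoothPer h) : ContDiff ℝ (⊤ : ℕ∞) (resolvent hμ hg hγ hh) := by
  exact contDiff_inverse_one_add_apply (E := C(Cyl, ℝ)) (contDiff_volterra hμ hg hγ)
    ((ContinuousLinearMap.contDiff _).comp (contDiff_pull hh)) (isUnit_one_add_volterra hμ hg hγ)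

theorem rescale_resolvent (hμ : 0 < μ) (hg : SmoothPer g) (hγ : SmoothPer γ)
    (hh : SmoothPer h) (σ₀ : unitInterval) (x₀ τ y : ℝ) :
    rescale σ₀ x₀ (resolvent hμ hg hγ hh (τ, y)) =
      resolvent hμ hg hγ hh (τ * σ₀, y + x₀) := by
  refine eq_of_add_volterra_eq hμ hg hγ (p := (τ * σ₀, y + x₀)) ?_
  rw [resolvent_add_volterra, ← rescale_volterra, ← rescale_pull, ← rescale_cylAverage,
    ← resolvent_add_volterra hμ hg hγ hh]
  rfl

/-- Solvability of the singular transport equation with a Volterra perturbation. -/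
theorem exists_transport (hμ : 0 < μ) (hg : SmoothPer g) (hγ : SmoothPer γ)
    (hh : SmoothPer h) :
    ∃ w, SmoothPer w ∧ ∀ t x,
      t * pt w t x - 2 * px w t x + μ * w t x + lowerOrder g γ w t x = h t x := by
  set W := resolvent hμ hg hγ hh with hW
  set w : ℝ → ℝ → ℝ := fun t x => W (t, x) basePoint with hw_def
  have hw : SmoothPer w :=
    { smooth := by
        have h1 : ContDiff ℝ (⊤ : ℕ∞) fun p => ContinuousMap.evalCLM ℝ basePoint (W p) :=
          (ContinuousLinearMap.contDiff _).comp (contDiff_resolvent hμ hg hγ hh)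
        exact h1
      periodic := fun t x => by
        have h1 : W (t, x + 2 * Real.pi) = W (t, x) := by
          refine eq_of_add_volterra_eq hμ hg hγ (p := (t, x)) ?_
          rw [resolvent_add_volterra, ← pull_add_two_pi hh, ← resolvent_add_volterra hμ hg hγ hh,
            volterra_apply, volterra_apply, pull_add_two_pi, pull_add_two_pi]
        exact congrArg (fun V : C(Cyl, ℝ) => V basePoint) h1 }
  have hpull : ∀ p, W p = pull hw p := by
    rintro ⟨τ, y⟩
    refine Cyl.ext_coe fun σ x => ?_
    rw [pull_apply]
    change _ = W (τ * σ, y + x) basePoint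
    rw [hW, ← rescale_resolvent, rescale_apply, basePoint, mul_one, ← AddCircle.coe_add, add_zero]
  have hl := smoothPer_lowerOrder hg hγ hw
  have hfix : w = average μ 2 fun t x => h t x - lowerOrder g γ w t x := by
    funext t x
    have h1 := resolvent_add_volterra hμ hg hγ hh (t, x)
    rw [← hW, hpull, volterra_pull, ← eq_sub_iff_add_eq, ← map_sub] at h1
    rw [← cylAverage_pull_basePoint 2 hμ (hh.sub hl), ← pull_basePoint hw, h1]
    have h2 : pull hh (t, x) - pull hl (t, x) = pull (hh.sub hl) (t, x) :=
      Cyl.ext_coe fun σ y => rfl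
    rw [h2]
  refine ⟨w, hw, fun t x => ?_⟩
  have h2 := transport_average 2 hμ (hh.sub hl) t x
  rw [← hfix] at h2
  linarith

/-- Uniqueness for the singular transport equation with a Volterra perturbation. -/
theorem eq_zero_of_transport (hμ : 0 < μ) (hg : SmoothPer g) (hγ : SmoothPer γ)
    (hq : SmoothPer q)
    (H : ∀ t x, 0 ≤ t → t * pt q t x - 2 * px q t x + μ * q t x + lowerOrder g γ q t x = 0)
    {t : ℝ} (ht : 0 ≤ t) (x : ℝ) : q t x = 0 := by
  have hl := smoothPer_lowerOrder hg hγ hq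
  have h1 : pull hq (t, x) = -volterra hμ hg hγ (t, x) (pull hq (t, x)) := by
    rw [volterra_pull, ← map_neg]
    refine Cyl.ext_coe fun σ y => ?_
    have h2 : -pull hl (t, x) = pull hl.neg (t, x) := Cyl.ext_coe fun σ y => rfl
    rw [h2, cylAverage_pull, pull_apply]
    refine eq_average_of_transport 2 hμ hl.neg hq _ _ fun s _ => ?_
    rw [eq_neg_iff_add_eq_zero]
    exact H _ _ (mul_nonneg (mul_nonneg ht σ.2.1) (Real.exp_pos _).le)
  have h3 : pull hq (t, x) = 0 := eq_of_add_volterra_eq hμ hg hγ (p := (t, x)) (by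
    rw [map_zero, add_zero, ← eq_neg_iff_add_eq_zero]
    exact h1)
  rw [← pull_basePoint hq, h3, ContinuousMap.zero_apply]

end Volterra

section Reduced

variable {μ : ℝ} {g γ f d : ℝ → ℝ → ℝ}

/-- Solvability of the reduced characteristic problem, in which the coefficient of `∂ₜ` is a
positive constant on the horizon and there is no `∂ₓ` term. -/
theorem exists_reduced (hμ : 0 < μ) (hg : SmoothPer g) (hγ : SmoothPer γ) (hf : SmoothPer f)
    {v₀ : ℝ → ℝ} (hv₀ : SmoothPer fun _ x => v₀ x) :
    ∃ v, SmoothPer v ∧ (∀ x, v 0 x = v₀ x) ∧ ∀ t x,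
      t * pt (pt v) t x - 2 * px (pt v) t x + (μ + t * g t x) * pt v t x + γ t x * v t x =
        f t x := by
  obtain ⟨w, hw, hw_eq⟩ := exists_transport hμ hg hγ (hf.sub (hγ.mul hv₀))
  have hpt : pt (fun t x => v₀ x + t * average 1 0 w t x) = w := by
    funext t x
    exact ((hasDerivAt_mul_average hw t x).const_add (v₀ x)).deriv
  refine ⟨fun t x => v₀ x + t * average 1 0 w t x,
    hv₀.add (smoothPer_time.mul (smoothPer_average 0 one_pos hw)), fun x => by simp,
    fun t x => ?_⟩
  rw [hpt]
  have h := hw_eq t x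
  rw [lowerOrder] at h
  linarith

/-- Uniqueness for the reduced characteristic problem. -/
theorem eq_zero_of_reduced (hμ : 0 < μ) (hg : SmoothPer g) (hγ : SmoothPer γ)
    (hd : SmoothPer d) (hd₀ : ∀ x, d 0 x = 0)
    (H : ∀ t x, 0 ≤ t →
      t * pt (pt d) t x - 2 * px (pt d) t x + (μ + t * g t x) * pt d t x + γ t x * d t x = 0)
    {t : ℝ} (ht : 0 ≤ t) (x : ℝ) : d t x = 0 := by
  have hd_eq : ∀ t x, d t x = t * average 1 0 (pt d) t x := fun t x => by
    rw [eq_add_mul_average_pt hd t x, hd₀, zero_add]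
  have hq : ∀ {s : ℝ}, 0 ≤ s → ∀ y, pt d s y = 0 := fun hs y =>
    eq_zero_of_transport hμ hg hγ hd.pt (fun t x ht => by
      have h := H t x ht
      rw [hd_eq t x] at h
      rw [lowerOrder]
      linarith) hs y
  rw [hd_eq, average]
  simp [hq (mul_nonneg ht (Real.exp_pos _).le)]

end Reduced

section Gauge

variable {a b c u v ψ : ℝ → ℝ → ℝ}

theorem misnerP_sub (hu : Smooth2 u) (hv : Smooth2 v) (t x : ℝ) :
    MisnerP a b c (fun t x => u t x - v t x) t x = MisnerP a b c u t x - MisnerP a b c v t x := by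
  have h1 : ∀ {u v}, Smooth2 u → Smooth2 v →
      pt (fun t x => u t x - v t x) = fun t x => pt u t x - pt v t x := fun hu hv => by
    funext t x
    exact ((hu.hasDerivAt_fst t x).sub (hv.hasDerivAt_fst t x)).deriv
  have h2 : ∀ {u v}, Smooth2 u → Smooth2 v →
      px (fun t x => u t x - v t x) = fun t x => px u t x - px v t x := fun hu hv => by
    funext t x
    exact ((hu.hasDerivAt_snd t x).sub (hv.hasDerivAt_snd t x)).deriv
  simp only [MisnerP, h1 hu hv, h2 hu hv, h1 hu.pt hv.pt, h2 hu.pt hv.pt]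
  ring

/-- The zeroth order coefficient of the operator conjugated with `exp ψ`. -/
def gaugePotential (a b c ψ : ℝ → ℝ → ℝ) : ℝ → ℝ → ℝ := fun t x =>
  t * pt (pt ψ) t x + t * (pt ψ t x * pt ψ t x) - 2 * px (pt ψ) t x - 2 * (px ψ t x * pt ψ t x)
    + pt ψ t x + a t x * px ψ t x + b t x * pt ψ t x + c t x

theorem smoothPer_gaugePotential (ha : SmoothPer a) (hb : SmoothPer b) (hc : SmoothPer c)
    (hψ : SmoothPer ψ) : SmoothPer (gaugePotential a b c ψ) :=
  (((((((smoothPer_time.mul hψ.pt.pt).add (smoothPer_time.mul (hψ.pt.mul hψ.pt))).sub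
    ((smoothPer_const 2).mul hψ.pt.px)).sub ((smoothPer_const 2).mul (hψ.px.mul hψ.pt))).add
    hψ.pt).add (ha.mul hψ.px)).add (hb.mul hψ.pt)).add hc

/-- Conjugation of the wave operator with `exp ψ`. -/
theorem misnerP_exp_mul (hψ : Smooth2 ψ) (hv : Smooth2 v) (t x : ℝ) :
    MisnerP a b c (fun t x => Real.exp (ψ t x) * v t x) t x =
      Real.exp (ψ t x) * (t * pt (pt v) t x - 2 * px (pt v) t x
        + (1 + b t x + 2 * t * pt ψ t x - 2 * px ψ t x) * pt v t x
        + (a t x - 2 * pt ψ t x) * px v t x + gaugePotential a b c ψ t x * v t x) := by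
  have h1 : ∀ {v}, Smooth2 v → pt (fun t x => Real.exp (ψ t x) * v t x) =
      fun t x => Real.exp (ψ t x) * (pt ψ t x * v t x + pt v t x) := fun hv => by
    funext t x
    exact (((hψ.hasDerivAt_fst t x).exp.mul (hv.hasDerivAt_fst t x)).congr_deriv
      (by ring)).deriv
  have h2 : ∀ {v}, Smooth2 v → px (fun t x => Real.exp (ψ t x) * v t x) =
      fun t x => Real.exp (ψ t x) * (px ψ t x * v t x + px v t x) := fun hv => by
    funext t x
    exact (((hψ.hasDerivAt_snd t x).exp.mul (hv.hasDerivAt_snd t x)).congr_deriv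
      (by ring)).deriv
  have hw : Smooth2 fun t x => pt ψ t x * v t x + pt v t x := (hψ.pt.mul hv).add hv.pt
  have h3 : pt (fun t x => pt ψ t x * v t x + pt v t x) t x =
      pt (pt ψ) t x * v t x + pt ψ t x * pt v t x + pt (pt v) t x :=
    (((hψ.pt.hasDerivAt_fst t x).mul (hv.hasDerivAt_fst t x)).add
      (hv.pt.hasDerivAt_fst t x)).deriv
  have h4 : px (fun t x => pt ψ t x * v t x + pt v t x) t x =
      px (pt ψ) t x * v t x + pt ψ t x * px v t x + px (pt v) t x :=
    (((hψ.pt.hasDerivAt_snd t x).mul (hv.hasDerivAt_snd t x)).add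
      (hv.pt.hasDerivAt_snd t x)).deriv
  rw [MisnerP, h1 hv, h2 hv, h1 hw, h2 hw]
  dsimp only
  rw [h3, h4, gaugePotential]
  ring

/-- A gauge function which removes the `∂ₓ` term and makes the coefficient of `∂ₜ` constant on the
horizon. -/
theorem exists_gauge (ha : SmoothPer a) (hb : SmoothPer b) (hb₀ : ∀ x, 0 ≤ b 0 x) :
    ∃ ψ m, SmoothPer ψ ∧ 0 ≤ m ∧ (∀ t x, 2 * pt ψ t x = a t x) ∧
      ∀ x, 2 * px ψ 0 x = b 0 x - m := by
  have hbs : ContDiff ℝ (⊤ : ℕ∞) (b 0) := hb.smooth.comp (contDiff_const.prodMk contDiff_id)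
  set m := (∫ y in (0 : ℝ)..2 * Real.pi, b 0 y) / (2 * Real.pi) with hm_def
  have hm : 0 ≤ m := div_nonneg
    (intervalIntegral.integral_nonneg Real.two_pi_pos.le fun y _ => hb₀ y) Real.two_pi_pos.le
  set k : ℝ → ℝ := fun y => b 0 y - m with hk_def
  have hk : ContDiff ℝ (⊤ : ℕ∞) k := hbs.sub contDiff_const
  have hkp : Function.Periodic k (2 * Real.pi) := fun y => by
    simp only [hk_def, hb.periodic 0 y]
  have hk0 : ∫ y in (0 : ℝ)..2 * Real.pi, k y = 0 := by
    rw [hk_def, intervalIntegral.integral_sub (hbs.continuous.intervalIntegrable _ _)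
      intervalIntegrable_const, intervalIntegral.integral_const, hm_def, smul_eq_mul, sub_zero,
      mul_div_cancel₀ _ Real.two_pi_pos.ne', sub_self]
  set I : ℝ → ℝ := fun x => ∫ y in (0 : ℝ)..x, k y with hI_def
  have hI : ∀ x, HasDerivAt I (k x) x := fun x =>
    (hk.continuous.integral_hasStrictDerivAt 0 x).hasDerivAt
  have hIs : ContDiff ℝ (⊤ : ℕ∞) I := by
    rw [contDiff_infty_iff_deriv]
    refine ⟨fun x => (hI x).differentiableAt, ?_⟩
    rwa [funext fun x => (hI x).deriv]
  have hIp : Function.Periodic I (2 * Real.pi) := fun x => by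
    have h1 := hkp.intervalIntegral_add_eq x 0
    rw [zero_add, hk0] at h1
    have h2 := intervalIntegral.integral_add_adjacent_intervals
      (hk.continuous.intervalIntegrable (μ := volume) 0 x)
      (hk.continuous.intervalIntegrable x (x + 2 * Real.pi))
    rw [h1, add_zero] at h2
    exact h2.symm
  refine ⟨fun t x => 1 / 2 * (I x + t * average 1 0 a t x), m,
    (smoothPer_const (1 / 2)).mul ((smoothPer_space hIs hIp).add
      (smoothPer_time.mul (smoothPer_average 0 one_pos ha))), hm, fun t x => ?_, fun x => ?_⟩
  · have h := ((hasDerivAt_mul_average ha t x).const_add (I x)).const_mul (1 / 2)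
    rw [pt, h.deriv]
    ring
  · have h : HasDerivAt (fun y => 1 / 2 * (I y + 0 * average 1 0 a 0 y)) (1 / 2 * k x) x := by
      simpa only [zero_mul, add_zero] using (hI x).const_mul (1 / 2)
    rw [px, h.deriv]
    ring

/-- After conjugation with a suitable `exp ψ`, the operator takes the reduced form. -/
theorem exists_reduction (ha : SmoothPer a) (hb : SmoothPer b) (hc : SmoothPer c)
    (hb₀ : ∀ x, 0 ≤ b 0 x) :
    ∃ ψ g γ μ, SmoothPer ψ ∧ SmoothPer g ∧ SmoothPer γ ∧ 0 < μ ∧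
      ∀ v, Smooth2 v → ∀ t x, MisnerP a b c (fun t x => Real.exp (ψ t x) * v t x) t x =
        Real.exp (ψ t x) * (t * pt (pt v) t x - 2 * px (pt v) t x
          + (μ + t * g t x) * pt v t x + γ t x * v t x) := by
  obtain ⟨ψ, m, hψ, hm, hψt, hψx⟩ := exists_gauge ha hb hb₀
  have hβ : SmoothPer fun t x => b t x + t * a t x - 2 * px ψ t x - m :=
    ((hb.add (smoothPer_time.mul ha)).sub ((smoothPer_const 2).mul hψ.px)).sub
      (smoothPer_const m)
  refine ⟨ψ, _, _, 1 + m, hψ, smoothPer_average 0 one_pos hβ.pt,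
    smoothPer_gaugePotential ha hb hc hψ, by linarith, fun v hv t x => ?_⟩
  have h := eq_add_mul_average_pt hβ t x
  simp only [zero_mul, add_zero, hψx, sub_sub_cancel, sub_self, zero_add] at h
  rw [misnerP_exp_mul hψ.smooth hv, ← h, ← hψt]
  ring

end Gauge

end

end Misner

/-- Well-posedness of the characteristic Cauchy problem for admissible scalar
wave equations on the Misner spacetime, with data only on the Cauchy horizon. -/
theorem stmt3 (a b c : ℝ → ℝ → ℝ)
    (ha : Smooth2 a) (hap : Periodic2 a)
    (hb : Smooth2 b) (hbp : Periodic2 b)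
    (hc : Smooth2 c) (hcp : Periodic2 c)
    (hadm : ∀ x : ℝ, 0 ≤ b 0 x)
    (u₀ : ℝ → ℝ) (hu₀ : ContDiff ℝ (⊤ : ℕ∞) u₀) (hu₀p : Function.Periodic u₀ (2 * Real.pi))
    (f : ℝ → ℝ → ℝ) (hf : Smooth2 f) (hfp : Periodic2 f) :
    ∃ u : ℝ → ℝ → ℝ,
      (Smooth2 u ∧ Periodic2 u ∧
        (∀ t x : ℝ, 0 ≤ t → MisnerP a b c u t x = f t x) ∧
        (∀ x : ℝ, u 0 x = u₀ x)) ∧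
      (∀ v : ℝ → ℝ → ℝ,
        (Smooth2 v ∧ Periodic2 v ∧
          (∀ t x : ℝ, 0 ≤ t → MisnerP a b c v t x = f t x) ∧
          (∀ x : ℝ, v 0 x = u₀ x)) →
        ∀ t x : ℝ, 0 ≤ t → v t x = u t x) := by
  obtain ⟨ψ, g, γ, μ, hψ, hg, hγ, hμ, hP⟩ :=
    Misner.exists_reduction ⟨ha, hap⟩ ⟨hb, hbp⟩ ⟨hc, hcp⟩ hadm
  have hcancel : ∀ t x r, Real.exp (ψ t x) * (Real.exp (-ψ t x) * r) = r := fun t x r => by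
    rw [← mul_assoc, ← Real.exp_add, add_neg_cancel, Real.exp_zero, one_mul]
  have hψ₀ : Misner.SmoothPer fun _ x => ψ 0 x := Misner.smoothPer_space
    (hψ.smooth.comp (contDiff_const.prodMk contDiff_id)) (hψ.periodic 0)
  obtain ⟨w, hw, hw₀, hw_eq⟩ := Misner.exists_reduced hμ hg hγ (hψ.neg.exp.mul ⟨hf, hfp⟩)
    (v₀ := fun x => Real.exp (-ψ 0 x) * u₀ x)
    (hψ₀.neg.exp.mul (Misner.smoothPer_space hu₀ hu₀p))
  have hu := hψ.exp.mul hw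
  have hu_eq : ∀ t x, MisnerP a b c (fun t x => Real.exp (ψ t x) * w t x) t x = f t x :=
    fun t x => by rw [hP w hw.smooth, hw_eq, hcancel]
  have hu_zero : ∀ x, Real.exp (ψ 0 x) * w 0 x = u₀ x := fun x => by rw [hw₀, hcancel]
  refine ⟨fun t x => Real.exp (ψ t x) * w t x,
    ⟨hu.smooth, hu.periodic, fun t x _ => hu_eq t x, hu_zero⟩, ?_⟩
  rintro v ⟨hv, hvp, hv_eq, hv_zero⟩ t x ht
  have hdiff := Misner.SmoothPer.sub ⟨hv, hvp⟩ hu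
  have hd := hψ.neg.exp.mul hdiff
  have h := Misner.eq_zero_of_reduced hμ hg hγ hd
    (fun x => by rw [hv_zero, hu_zero, sub_self, mul_zero])
    (fun t x ht => by
      have h1 := hP _ hd.smooth t x
      simp only [hcancel] at h1
      rw [Misner.misnerP_sub hv hu.smooth, hv_eq t x ht, hu_eq, sub_self, eq_comm] at h1
      exact (mul_eq_zero.1 h1).resolve_left (Real.exp_pos _).ne') ht x
  exact sub_eq_zero.1 ((mul_eq_zero.1 h).resolve_left (Real.exp_pos _).ne')
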